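/- Let N ≥ 1, let k₁,…,k_N be nonzero real constants, let n ≥ 3 be an integer, and let u, v : ℝ^N → ℝ be C^∞ functions. Define coefficients d_k^n for 3 ≤ k ≤ n by: d₃^n = 2(n−2)(n+1) + 4 for n ≥ 3; d_n^n = n·2^{n−1} for n ≥ 4; and d_k^n = 2·Σ_{j=k}^{n−1} d_{k−1}^j + d_k^k for 4 ≤ k ≤ n−1. Then □ⁿ(u·v) = Σ_{α=0}^{n} C(n,α)·(□^{n−α}u)·(□^α v) + 2n·Σ_{α=0}^{n−1} C(n−1,α)·◊(□^{n−1−α}u, □^α v) + Σ_{k=3}^{n} d_k^n · Σ_{α=0}^{n−k+1} C(n−k+1,α)·◊^{k−1}(□^{n−k+1−α}u, □^α v) + 2ⁿ·◊ⁿ(u,v), where □ⁿ denotes the n-fold iterate of □ and C(n,α) is the binomial coefficient. -/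

import Mathlib

variable {N : ℕ}

/-- Partial derivative in the `i`-th coordinate direction. -/
noncomputable def pd (i : Fin N) (f : (Fin N → ℝ) → ℝ) : (Fin N → ℝ) → ℝ :=
  fun x => fderiv ℝ f x (Pi.single i 1)

/-- Iterated partial derivative along a list of coordinate directions. -/
noncomputable def mpd : List (Fin N) → ((Fin N → ℝ) → ℝ) → ((Fin N → ℝ) → ℝ)
  | [], f => f
  | i :: l, f => pd i (mpd l f)

/-- The operator `□w = Σ_{i=1}^N (1/k_i) ∂²w/∂x_i²`. -/
noncomputable def box (k : Fin N → ℝ) (f : (Fin N → ℝ) → ℝ) : (Fin N → ℝ) → ℝ :=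
  fun x => ∑ i : Fin N, (1 / k i) * pd i (pd i f) x

/-- The bilinear operator
`◊^m(u,v) = Σ_{i₁,…,i_m} (1/(k_{i₁}⋯k_{i_m})) (∂^m u/∂x_{i₁}⋯∂x_{i_m})·(∂^m v/∂x_{i₁}⋯∂x_{i_m})`. -/
noncomputable def diam (k : Fin N → ℝ) (m : ℕ) (u v : (Fin N → ℝ) → ℝ) :
    (Fin N → ℝ) → ℝ :=
  fun x => ∑ ι : Fin m → Fin N,
    (∏ j : Fin m, 1 / k (ι j)) * mpd (List.ofFn ι) u x * mpd (List.ofFn ι) v x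

theorem ContDiff.pd {f : (Fin N → ℝ) → ℝ} (hf : ContDiff ℝ (⊤ : ℕ∞) f) (i : Fin N) :
    ContDiff ℝ (⊤ : ℕ∞) (pd i f) :=
  (hf.fderiv_right (m := (⊤ : ℕ∞)) (by simp)).clm_apply contDiff_const

theorem ContDiff.mpd {f : (Fin N → ℝ) → ℝ} (hf : ContDiff ℝ (⊤ : ℕ∞) f) (l : List (Fin N)) :
    ContDiff ℝ (⊤ : ℕ∞) (mpd l f) := by
  induction l with
  | nil => exact hf
  | cons i l ih => exact ih.pd i

theorem ContDiff.box {f : (Fin N → ℝ) → ℝ} (hf : ContDiff ℝ (⊤ : ℕ∞) f) (k : Fin N → ℝ) :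
    ContDiff ℝ (⊤ : ℕ∞) (box k f) :=
  ContDiff.sum fun i _ => contDiff_const.mul ((hf.pd i).pd i)

theorem ContDiff.box_iterate {f : (Fin N → ℝ) → ℝ} (hf : ContDiff ℝ (⊤ : ℕ∞) f)
    (k : Fin N → ℝ) (n : ℕ) : ContDiff ℝ (⊤ : ℕ∞) ((_root_.box k)^[n] f) := by
  induction n with
  | zero => exact hf
  | succ n ih => rw [Function.iterate_succ_apply']; exact ih.box k

theorem ContDiff.diam {u v : (Fin N → ℝ) → ℝ} (hu : ContDiff ℝ (⊤ : ℕ∞) u)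
    (hv : ContDiff ℝ (⊤ : ℕ∞) v) (k : Fin N → ℝ) (m : ℕ) :
    ContDiff ℝ (⊤ : ℕ∞) (diam k m u v) :=
  ContDiff.sum fun _ _ => (contDiff_const.mul (hu.mpd _)).mul (hv.mpd _)

theorem ContDiff.differentiable_of_top {f : (Fin N → ℝ) → ℝ} (hf : ContDiff ℝ (⊤ : ℕ∞) f) :
    Differentiable ℝ f :=
  hf.differentiable (by simp)

/-- `ContDiff.const_smul` for the pointwise scalar multiple as a term of the function space. -/
theorem ContDiff.smul_left {f : (Fin N → ℝ) → ℝ} (hf : ContDiff ℝ (⊤ : ℕ∞) f) (c : ℝ) :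
    ContDiff ℝ (⊤ : ℕ∞) (c • f) :=
  hf.const_smul c

theorem pd_mul (i : Fin N) {f g : (Fin N → ℝ) → ℝ} (hf : Differentiable ℝ f)
    (hg : Differentiable ℝ g) : pd i (f * g) = pd i f * g + f * pd i g := by
  funext x
  simp only [pd, fderiv_mul (hf x) (hg x), Pi.add_apply, Pi.mul_apply]
  simp
  ring

theorem pd_add (i : Fin N) {f g : (Fin N → ℝ) → ℝ} (hf : Differentiable ℝ f)
    (hg : Differentiable ℝ g) : pd i (f + g) = pd i f + pd i g := by
  funext x
  simp [pd, fderiv_add (hf x) (hg x)]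

theorem pd_smul (i : Fin N) (c : ℝ) (f : (Fin N → ℝ) → ℝ) : pd i (c • f) = c • pd i f := by
  funext x
  simp [pd, fderiv_const_smul_field]

theorem pd_sum {ι : Type*} (i : Fin N) (s : Finset ι) {f : ι → (Fin N → ℝ) → ℝ}
    (hf : ∀ j ∈ s, Differentiable ℝ (f j)) : pd i (∑ j ∈ s, f j) = ∑ j ∈ s, pd i (f j) := by
  funext x
  simp only [pd, fderiv_sum fun j hj => hf j hj x, Finset.sum_apply]
  simp

theorem pd_comm (i j : Fin N) {f : (Fin N → ℝ) → ℝ} (hf : ContDiff ℝ (⊤ : ℕ∞) f) :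
    pd i (pd j f) = pd j (pd i f) := by
  funext x
  have hd : DifferentiableAt ℝ (fderiv ℝ f) x :=
    (hf.fderiv_right (m := (⊤ : ℕ∞)) (by simp)).differentiable (by simp) x
  have key (a b : Fin N) : pd a (pd b f) x =
      fderiv ℝ (fderiv ℝ f) x (Pi.single a 1) (Pi.single b 1) := by
    unfold pd
    rw [fderiv_clm_apply hd (differentiableAt_const _)]
    simp
  rw [key, key]
  exact (hf.contDiffAt.isSymmSndFDerivAt (by
    rw [minSmoothness_of_isRCLikeNormedField]
    exact WithTop.coe_le_coe.2 (le_top : (2 : ℕ∞) ≤ ⊤))) _ _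

theorem box_eq_sum (k : Fin N → ℝ) (f : (Fin N → ℝ) → ℝ) :
    box k f = ∑ i, (1 / k i) • pd i (pd i f) := by
  funext x
  simp [box]

theorem box_smul (k : Fin N → ℝ) (c : ℝ) (f : (Fin N → ℝ) → ℝ) :
    box k (c • f) = c • box k f := by
  simp only [box_eq_sum, pd_smul, Finset.smul_sum]
  exact Finset.sum_congr rfl fun i _ => smul_comm _ _ _

theorem box_sum {ι : Type*} (k : Fin N → ℝ) (s : Finset ι) {f : ι → (Fin N → ℝ) → ℝ}
    (hf : ∀ j ∈ s, ContDiff ℝ (⊤ : ℕ∞) (f j)) :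
    box k (∑ j ∈ s, f j) = ∑ j ∈ s, box k (f j) := by
  simp only [box_eq_sum]
  rw [Finset.sum_comm]
  refine Finset.sum_congr rfl fun i _ => ?_
  rw [pd_sum i s fun j hj => (hf j hj).differentiable_of_top,
    pd_sum i s fun j hj => ((hf j hj).pd i).differentiable_of_top, Finset.smul_sum]

theorem box_add (k : Fin N → ℝ) {f g : (Fin N → ℝ) → ℝ} (hf : ContDiff ℝ (⊤ : ℕ∞) f)
    (hg : ContDiff ℝ (⊤ : ℕ∞) g) : box k (f + g) = box k f + box k g := by
  simp only [box_eq_sum, ← Finset.sum_add_distrib, ← smul_add]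
  refine Finset.sum_congr rfl fun i _ => ?_
  rw [pd_add i hf.differentiable_of_top hg.differentiable_of_top,
    pd_add i (hf.pd i).differentiable_of_top (hg.pd i).differentiable_of_top]

theorem box_pd (k : Fin N → ℝ) (j : Fin N) {f : (Fin N → ℝ) → ℝ}
    (hf : ContDiff ℝ (⊤ : ℕ∞) f) : box k (pd j f) = pd j (box k f) := by
  simp only [box_eq_sum]
  rw [pd_sum j _ fun i _ => (((hf.pd i).pd i).smul_left (1 / k i)).differentiable_of_top]
  refine Finset.sum_congr rfl fun i _ => ?_
  rw [pd_smul, pd_comm i j hf, pd_comm i j (hf.pd i)]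

/-- `box` commutes with iterated partial derivatives. -/
theorem box_mpd (k : Fin N → ℝ) (l : List (Fin N)) {f : (Fin N → ℝ) → ℝ}
    (hf : ContDiff ℝ (⊤ : ℕ∞) f) : box k (mpd l f) = mpd l (box k f) := by
  induction l with
  | nil => rfl
  | cons j l ih => simp only [mpd, box_pd k j (hf.mpd l), ih]

theorem box_mul (k : Fin N → ℝ) {f g : (Fin N → ℝ) → ℝ} (hf : ContDiff ℝ (⊤ : ℕ∞) f)
    (hg : ContDiff ℝ (⊤ : ℕ∞) g) :
    box k (f * g) = box k f * g + f * box k g + (2 : ℝ) • ∑ i, (1 / k i) • (pd i f * pd i g) := by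
  simp only [box_eq_sum, Finset.sum_mul, Finset.mul_sum, Finset.smul_sum,
    ← Finset.sum_add_distrib]
  refine Finset.sum_congr rfl fun i _ => ?_
  have hf₀ := hf.differentiable_of_top
  have hg₀ := hg.differentiable_of_top
  have hf₁ := (hf.pd i).differentiable_of_top
  have hg₁ := (hg.pd i).differentiable_of_top
  rw [pd_mul i hf₀ hg₀, pd_add i (hf₁.mul hg₀) (hf₀.mul hg₁), pd_mul i hf₁ hg₀, pd_mul i hf₀ hg₁]
  funext x
  simp only [Pi.add_apply, Pi.mul_apply, Pi.smul_apply, smul_eq_mul]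
  ring

theorem diam_eq_sum (k : Fin N → ℝ) (m : ℕ) (u v : (Fin N → ℝ) → ℝ) :
    diam k m u v = ∑ ι : Fin m → Fin N,
      (∏ j, 1 / k (ι j)) • (mpd (List.ofFn ι) u * mpd (List.ofFn ι) v) := by
  funext x
  simp [diam, mul_assoc]

theorem diam_zero (k : Fin N → ℝ) (u v : (Fin N → ℝ) → ℝ) : diam k 0 u v = u * v := by
  simp [diam_eq_sum, mpd]

theorem diam_succ (k : Fin N → ℝ) (m : ℕ) (u v : (Fin N → ℝ) → ℝ) :
    diam k (m + 1) u v = ∑ ι : Fin m → Fin N, (∏ j, 1 / k (ι j)) •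
      ∑ i, (1 / k i) • (pd i (mpd (List.ofFn ι) u) * pd i (mpd (List.ofFn ι) v)) := by
  rw [diam_eq_sum, ← (Fin.consEquiv fun _ => Fin N).sum_comp, Fintype.sum_prod_type,
    Finset.sum_comm]
  refine Finset.sum_congr rfl fun ι _ => ?_
  rw [Finset.smul_sum]
  refine Finset.sum_congr rfl fun i _ => ?_
  simp [Fin.prod_univ_succ, Fin.consEquiv, List.ofFn_succ, mpd, smul_smul, mul_comm]

/-- Product rule for `box` applied to `diam`. -/
theorem box_diam (k : Fin N → ℝ) (m : ℕ) {u v : (Fin N → ℝ) → ℝ}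
    (hu : ContDiff ℝ (⊤ : ℕ∞) u) (hv : ContDiff ℝ (⊤ : ℕ∞) v) :
    box k (diam k m u v) =
      diam k m (box k u) v + diam k m u (box k v) + (2 : ℝ) • diam k (m + 1) u v := by
  rw [diam_succ]
  simp only [diam_eq_sum]
  rw [box_sum k _ fun ι _ => ContDiff.smul_left (f := _ * _) ((hu.mpd _).mul (hv.mpd _)) _, Finset.smul_sum,
    ← Finset.sum_add_distrib, ← Finset.sum_add_distrib]
  refine Finset.sum_congr rfl fun ι _ => ?_
  rw [box_smul, box_mul k (hu.mpd _) (hv.mpd _), box_mpd k _ hu, box_mpd k _ hv, smul_add,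
    smul_add, smul_comm (2 : ℝ)]

theorem box_iterate_add (k : Fin N → ℝ) (n : ℕ) {f g : (Fin N → ℝ) → ℝ}
    (hf : ContDiff ℝ (⊤ : ℕ∞) f) (hg : ContDiff ℝ (⊤ : ℕ∞) g) :
    (box k)^[n] (f + g) = (box k)^[n] f + (box k)^[n] g := by
  induction n with
  | zero => rfl
  | succ n ih =>
    simp only [Function.iterate_succ_apply', ih, box_add k (hf.box_iterate k n)
      (hg.box_iterate k n)]

theorem box_iterate_smul (k : Fin N → ℝ) (n : ℕ) (c : ℝ) (f : (Fin N → ℝ) → ℝ) :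
    (box k)^[n] (c • f) = c • (box k)^[n] f := by
  induction n with
  | zero => rfl
  | succ n ih => simp only [Function.iterate_succ_apply', ih, box_smul]

/-- The shift operator `F ↦ F (· + a)` on functions of three natural number indices. -/
def shift (E : Type*) [AddCommGroup E] [Module ℝ E] (a : ℕ × ℕ × ℕ) :
    Module.End ℝ (ℕ × ℕ × ℕ → E) :=
  LinearMap.funLeft ℝ E (· + a)

theorem shift_mul (E : Type*) [AddCommGroup E] [Module ℝ E] (a b : ℕ × ℕ × ℕ) :
    shift E a * shift E b = shift E (a + b) := by
  ext F p
  simp [shift, LinearMap.funLeft_apply, add_assoc]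

theorem shift_pow (E : Type*) [AddCommGroup E] [Module ℝ E] (a : ℕ × ℕ × ℕ) (n : ℕ) :
    shift E a ^ n = shift E (n • a) := by
  induction n with
  | zero => ext F p; simp [shift, LinearMap.funLeft_apply]
  | succ n ih => rw [pow_succ, ih, shift_mul, succ_nsmul]

theorem shift_commute (E : Type*) [AddCommGroup E] [Module ℝ E] (a b : ℕ × ℕ × ℕ) :
    Commute (shift E a) (shift E b) := by
  rw [Commute, SemiconjBy, shift_mul, shift_mul, add_comm]

/-- Trinomial expansion of powers of a sum of coordinate shifts. -/
theorem shift_add_pow_apply (E : Type*) [AddCommGroup E] [Module ℝ E] (n : ℕ)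
    (F : ℕ × ℕ × ℕ → E) :
    ((shift E (1, 0, 0) + shift E (0, 1, 0) + (2 : ℝ) • shift E (0, 0, 1)) ^ n) F 0 =
      ∑ m ∈ Finset.range (n + 1), ((n.choose m : ℝ) * 2 ^ m) •
        ∑ α ∈ Finset.range (n - m + 1), ((n - m).choose α : ℝ) • F (n - m - α, α, m) := by
  have hC : Commute ((2 : ℝ) • shift E (0, 0, 1)) (shift E (1, 0, 0) + shift E (0, 1, 0)) :=
    ((shift_commute E _ _).add_right (shift_commute E _ _)).smul_left _
  rw [add_comm, hC.add_pow, LinearMap.sum_apply, Finset.sum_apply]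
  refine Finset.sum_congr rfl fun m _ => ?_
  rw [add_comm (shift E (1, 0, 0)), (shift_commute E _ _).add_pow]
  simp only [smul_pow, shift_pow, ← nsmul_eq_mul', smul_mul_assoc, Finset.mul_sum, shift_mul,
    mul_smul_comm, LinearMap.sum_apply, LinearMap.smul_apply, Finset.sum_apply, Pi.smul_apply,
    Finset.smul_sum]
  refine Finset.sum_congr rfl fun α _ => ?_
  simp only [← Nat.cast_smul_eq_nsmul ℝ, smul_smul]
  simp [shift, LinearMap.funLeft_apply]
  ring_nf

theorem box_iterate_diam (k : Fin N → ℝ) {u v : (Fin N → ℝ) → ℝ}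
    (hu : ContDiff ℝ (⊤ : ℕ∞) u) (hv : ContDiff ℝ (⊤ : ℕ∞) v) (n : ℕ) (p : ℕ × ℕ × ℕ) :
    (box k)^[n] (diam k p.2.2 ((box k)^[p.1] u) ((box k)^[p.2.1] v)) =
      ((shift _ (1, 0, 0) + shift _ (0, 1, 0) + (2 : ℝ) • shift _ (0, 0, 1)) ^ n :
        Module.End ℝ (ℕ × ℕ × ℕ → (Fin N → ℝ) → ℝ))
        (fun q => diam k q.2.2 ((box k)^[q.1] u) ((box k)^[q.2.1] v)) p := by
  induction n generalizing p with
  | zero => rfl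
  | succ n ih =>
    obtain ⟨i, j, m⟩ := p
    have hui := hu.box_iterate k
    have hvj := hv.box_iterate k
    have h₁ := ((hui i).box k).diam (hvj j) k m
    have h₂ := (hui i).diam ((hvj j).box k) k m
    have ih₁ := ih (i + 1, j, m)
    have ih₂ := ih (i, j + 1, m)
    simp only [Function.iterate_succ_apply'] at ih₁ ih₂
    rw [Function.iterate_succ_apply, box_diam k m (hui i) (hvj j),
      box_iterate_add k n (f := _ + _) (h₁.add h₂) (((hui i).diam (hvj j) k _).smul_left _),
      box_iterate_add k n h₁ h₂,
      box_iterate_smul, ih₁, ih₂, ih (i, j, m + 1), pow_succ']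
    rfl

/-- Leibniz rule for iterates of `box`, with binomial coefficients. -/
theorem box_iterate_mul (k : Fin N → ℝ) {u v : (Fin N → ℝ) → ℝ}
    (hu : ContDiff ℝ (⊤ : ℕ∞) u) (hv : ContDiff ℝ (⊤ : ℕ∞) v) (n : ℕ) :
    (box k)^[n] (u * v) = ∑ m ∈ Finset.range (n + 1), ((n.choose m : ℝ) * 2 ^ m) •
      ∑ α ∈ Finset.range (n - m + 1), ((n - m).choose α : ℝ) •
        diam k m ((box k)^[n - m - α] u) ((box k)^[α] v) := by
  have h := box_iterate_diam k hu hv n 0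
  rw [shift_add_pow_apply] at h
  simpa [diam_zero] using h

theorem sum_choose_Icc_add (c m : ℕ) (h : c + 2 ≤ m) :
    ∑ j ∈ Finset.Icc (c + 2) (m - 1), j.choose c + (c + 2) = m.choose (c + 1) := by
  induction m, h using Nat.le_induction with
  | base => simp [Nat.choose_succ_self_right]
  | succ m hm ih =>
    obtain ⟨m, rfl⟩ : ∃ t, m = t + 1 := ⟨m - 1, by omega⟩
    rw [Nat.add_sub_cancel, Finset.sum_Icc_succ_top hm, Nat.choose_succ_succ (m + 1), ← ih]
    simp only [Nat.add_sub_cancel]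
    ring

theorem coeff_eq_choose_mul_two_pow (d : ℕ → ℕ → ℕ)
    (hd3 : ∀ m, 3 ≤ m → d 3 m = 2 * (m - 2) * (m + 1) + 4)
    (hddiag : ∀ m, 4 ≤ m → d m m = m * 2 ^ (m - 1))
    (hdrec : ∀ K m, 4 ≤ K → K ≤ m - 1 →
      d K m = 2 * (∑ j ∈ Finset.Icc K (m - 1), d (K - 1) j) + d K K)
    (K m : ℕ) (hK : 3 ≤ K) (hm : K ≤ m) : d K m = m.choose (K - 1) * 2 ^ (K - 1) := by
  induction K, hK using Nat.le_induction generalizing m with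
  | base =>
    rw [hd3 m hm]
    obtain ⟨t, rfl⟩ : ∃ t, m = t + 2 := ⟨m - 2, by omega⟩
    have h : (t + 2).choose 2 * 2 = (t + 2) * (t + 1) := by
      rw [show t + 1 = t + 2 - 1 from rfl, ← Finset.sum_range_id_mul_two (t + 2),
        Finset.sum_range_id, Nat.choose_two_right]
    norm_num
    nlinarith
  | succ K hK ih =>
    rcases hm.eq_or_lt with rfl | hlt
    · rw [hddiag _ (by omega)]
      simp [Nat.choose_succ_self_right]
    · rw [hdrec _ _ (by omega) (by omega), hddiag _ (by omega), Nat.add_sub_cancel,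
        Finset.sum_congr rfl fun j hj => ih j (by have := Finset.mem_Icc.1 hj; omega),
        ← Finset.sum_mul]
      obtain ⟨c, rfl⟩ : ∃ c, K = c + 1 := ⟨K - 1, by omega⟩
      rw [← sum_choose_Icc_add c m (by omega)]
      simp only [Nat.add_sub_cancel]
      ring

/-- The general formula of Proposition 2.2 (Leibniz-type formula for `□ⁿ(uv)`). -/
theorem box_pow_mul (hN : 1 ≤ N) (k : Fin N → ℝ) (hk : ∀ i, k i ≠ 0)
    (n : ℕ) (hn : 3 ≤ n)
    (d : ℕ → ℕ → ℕ)
    (hd3 : ∀ m, 3 ≤ m → d 3 m = 2 * (m - 2) * (m + 1) + 4)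
    (hddiag : ∀ m, 4 ≤ m → d m m = m * 2 ^ (m - 1))
    (hdrec : ∀ K m, 4 ≤ K → K ≤ m - 1 →
      d K m = 2 * (∑ j ∈ Finset.Icc K (m - 1), d (K - 1) j) + d K K)
    (u v : (Fin N → ℝ) → ℝ) (hu : ContDiff ℝ (⊤ : ℕ∞) u) (hv : ContDiff ℝ (⊤ : ℕ∞) v) :
    (box k)^[n] (fun x => u x * v x) =
      fun x =>
        (∑ α ∈ Finset.range (n + 1),
          (Nat.choose n α : ℝ) * (box k)^[n - α] u x * (box k)^[α] v x) +
        2 * (n : ℝ) * (∑ α ∈ Finset.range n,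
          (Nat.choose (n - 1) α : ℝ) *
            diam k 1 ((box k)^[n - 1 - α] u) ((box k)^[α] v) x) +
        (∑ K ∈ Finset.Icc 3 n, (d K n : ℝ) *
          ∑ α ∈ Finset.range (n - K + 2),
            (Nat.choose (n - K + 1) α : ℝ) *
              diam k (K - 1) ((box k)^[n - K + 1 - α] u) ((box k)^[α] v) x) +
        2 ^ n * diam k n u v x := by
  have hd := coeff_eq_choose_mul_two_pow d hd3 hddiag hdrec
  change (box k)^[n] (u * v) = _
  rw [box_iterate_mul k hu hv]
  funext x
  simp only [Finset.sum_apply, Pi.smul_apply, smul_eq_mul]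
  obtain ⟨n, rfl⟩ : ∃ t, n = t + 1 := ⟨n - 1, by omega⟩
  rw [Finset.sum_range_succ, ← Finset.sum_range_add_sum_Ico _ (show 2 ≤ n + 1 by omega)]
  have hIcc : Finset.Icc 3 (n + 1) = Finset.Ico (2 + 1) (n + 1 + 1) := by ext; simp
  rw [hIcc, ← Finset.sum_Ico_add']
  have hsum : ∀ m ∈ Finset.Ico 2 (n + 1),
      (((n + 1).choose m : ℝ) * 2 ^ m) * ∑ α ∈ Finset.range (n + 1 - m + 1),
        ((n + 1 - m).choose α : ℝ) * diam k m ((box k)^[n + 1 - m - α] u) ((box k)^[α] v) x =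
      (d (m + 1) (n + 1) : ℝ) * ∑ α ∈ Finset.range (n + 1 - (m + 1) + 2),
        ((n + 1 - (m + 1) + 1).choose α : ℝ) *
          diam k (m + 1 - 1) ((box k)^[n + 1 - (m + 1) + 1 - α] u) ((box k)^[α] v) x := by
    intro m hm
    rw [Finset.mem_Ico] at hm
    rw [hd (m + 1) (n + 1) (by omega) (by omega), Nat.add_sub_cancel,
      show n + 1 - (m + 1) + 2 = n + 1 - m + 1 by omega,
      show n + 1 - (m + 1) + 1 = n + 1 - m by omega]
    push_cast
    rfl
  rw [← Finset.sum_congr rfl hsum, Finset.sum_range_succ _ 1, Finset.sum_range_one]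
  simp [diam_zero, mul_assoc]
  ring
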